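/- arXiv:quant-ph/0101133 — 5 statements merged into one kernel-verified Lean document; each statement's English description precedes it below -/
import Mathlib

section
/- For every natural number n, every state A of the reversible pebble game, and every node j ∈ A such that none of the nodes j+1, j+2, ..., j+2^n − 1 belongs to A, there exists a sequence of exactly 3^n legal moves leading from A to the state A Δ {j + 2^n} (the symmetric difference, so that the pebble on node j + 2^n is toggled), such that every state B occurring in the sequence satisfies A \ {j + 2^n} ⊆ B ⊆ A ∪ {j+1, j+2, ..., j+2^n} and the cardinality of B \ A is at most n + 1. -/
/-- A legal move of the reversible pebble game: toggle the pebble on node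
`i + 1` for some pebbled node `i ∈ A`, i.e. replace `A` by `A ∆ {i+1}`. -/
def PebbleMove (A B : Finset ℕ) : Prop :=
  ∃ i ∈ A, B = symmDiff A {i + 1}

inductive PPath (P : Finset ℕ → Prop) : ℕ → Finset ℕ → Finset ℕ → Prop
  | nil (A : Finset ℕ) : P A → PPath P 0 A A
  | cons (k : ℕ) (A B C : Finset ℕ) : P A → PebbleMove A B → PPath P k B C → PPath P (k + 1) A C

theorem PPath.mono {P Q : Finset ℕ → Prop} (h : ∀ B, P B → Q B) {k A B}
    (p : PPath P k A B) : PPath Q k A B := by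
  induction p with
  | nil A hA => exact .nil A (h _ hA)
  | cons k A B C hA m _ ih => exact .cons k A B C (h _ hA) m ih

theorem PPath.append {P : Finset ℕ → Prop} {k l A B C}
    (p : PPath P k A B) (q : PPath P l B C) : PPath P (l + k) A C := by
  induction p with
  | nil A hA => exact q
  | cons k A B D hA m _ ih => exact .cons (l + k) A B C hA m (ih q)

theorem PPath.toList {P : Finset ℕ → Prop} {k A B} (p : PPath P k A B) :
    ∃ L : List (Finset ℕ), L.length = k + 1 ∧ L.head? = some A ∧ L.getLast? = some B ∧
      List.IsChain PebbleMove L ∧ ∀ B ∈ L, P B := by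
  induction p with
  | nil A hA => exact ⟨[A], by simp [hA]⟩
  | cons k A B C hA m _ ih =>
    obtain ⟨L, h1, h2, h3, h4, h5⟩ := ih
    cases L with
    | nil => simp at h2
    | cons x l =>
      simp only [List.head?_cons, Option.some.injEq] at h2
      subst h2
      refine ⟨A :: x :: l, by simpa using h1, rfl, by simpa using h3,
        List.IsChain.cons_cons m h4, ?_⟩
      intro B hB
      rcases List.mem_cons.1 hB with rfl | hB
      · exact hA
      · exact h5 _ hB

def PInv (n : ℕ) (A : Finset ℕ) (j t : ℕ) (B : Finset ℕ) : Prop :=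
  A \ {t} ⊆ B ∧ B ⊆ A ∪ Finset.Icc (j + 1) t ∧ (B \ (A \ {t})).card ≤ n + 1

theorem card_step {X Y : Finset ℕ} {n x : ℕ} (h : X ⊆ insert x Y) (hY : Y.card ≤ n + 1) :
    X.card ≤ n + 1 + 1 :=
  (Finset.card_le_card h).trans ((Finset.card_insert_le _ _).trans (by omega))

theorem pebble_aux (n : ℕ) : ∀ (A : Finset ℕ) (j : ℕ), j ∈ A →
    (∀ i, j < i → i < j + 2 ^ n → i ∉ A) →
    PPath (PInv n A j (j + 2 ^ n)) (3 ^ n) A (symmDiff A {j + 2 ^ n}) := by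
  induction n with
  | zero =>
    intro A j hj _
    refine .cons 0 _ _ _ ?_ ⟨j, hj, rfl⟩ (.nil _ ?_)
    all_goals
      refine ⟨?_, ?_, Finset.card_le_one_iff_subset_singleton.2 ⟨j + 1, ?_⟩⟩ <;>
      · intro x
        simp [Finset.mem_symmDiff]
        try grind
  | succ n ih =>
    intro A j hj hgap
    have hp : 0 < 2 ^ n := by positivity
    have h2 : j + 2 ^ (n + 1) = (j + 2 ^ n) + 2 ^ n := by ring
    have h3 : 3 ^ (n + 1) = 3 ^ n + (3 ^ n + 3 ^ n) := by ring
    rw [h2] at hgap ⊢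
    rw [h3]
    generalize hd : 2 ^ n = d at *
    have hm : j + d ∉ A := hgap _ (by omega) (by omega)
    have p1 := ih A j hj (fun i h h' => hgap i h (by omega))
    have p2 := ih (symmDiff A {j + d}) (j + d) (by simp [Finset.mem_symmDiff, hm])
      (fun i h h' => by
        have := hgap i (by omega) h'
        simp [Finset.mem_symmDiff, this]; omega)
    have p3 := ih (symmDiff (symmDiff A {j + d}) {j + d + d}) j
      (by simp [Finset.mem_symmDiff, hj]; omega)
      (fun i h h' => by
        have := hgap i (by omega) (by omega)
        simp [Finset.mem_symmDiff, this]; omega)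
    have e : symmDiff (symmDiff (symmDiff A {j + d}) {j + d + d}) {j + d}
        = symmDiff A {j + d + d} := by
      rw [symmDiff_right_comm, symmDiff_symmDiff_cancel_right]
    rw [e] at p3
    refine ((p1.mono ?_).append (p2.mono ?_)).append (p3.mono ?_) 
    · rintro B ⟨a, b, c⟩
      refine ⟨?_, ?_, card_step (x := j + d + d) ?_ c⟩ <;> intro x <;>
        have a := @a x <;> have b := @b x <;>
        simp only [Finset.mem_symmDiff, Finset.mem_sdiff, Finset.mem_union, Finset.mem_Icc,
          Finset.mem_singleton, Finset.mem_insert] at * <;> grind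
    · rintro B ⟨a, b, c⟩
      refine ⟨?_, ?_, card_step (x := j + d) ?_ c⟩ <;> intro x <;>
        have a := @a x <;> have b := @b x <;>
        simp only [Finset.mem_symmDiff, Finset.mem_sdiff, Finset.mem_union, Finset.mem_Icc,
          Finset.mem_singleton, Finset.mem_insert] at * <;> grind
    · rintro B ⟨a, b, c⟩
      refine ⟨?_, ?_, card_step (x := j + d + d) ?_ c⟩ <;> intro x <;>
        have a := @a x <;> have b := @b x <;>
        simp only [Finset.mem_symmDiff, Finset.mem_sdiff, Finset.mem_union, Finset.mem_Icc,
          Finset.mem_singleton, Finset.mem_insert] at * <;> grind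

/-- Correctness of Bennett's recursive procedure `pebble(s,t,n)`:
from a state `A` (containing the permanent pebble on node 0) with a pebble on
node `j` and no pebbles on nodes `j+1, …, j+2^n − 1`, there is a sequence of
exactly `3^n` legal moves ending in `A ∆ {j + 2^n}`, in which every
intermediate state `B` satisfies `A \ {j+2^n} ⊆ B ⊆ A ∪ {j+1, …, j+2^n}` and
`|B \ A| ≤ n + 1`. -/
theorem pebble_correct (n : ℕ) (A : Finset ℕ) (j : ℕ)
    (h0 : 0 ∈ A) (hj : j ∈ A)
    (hgap : ∀ i ∈ Finset.Ico (j + 1) (j + 2 ^ n), i ∉ A) :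
    ∃ L : List (Finset ℕ),
      L.length = 3 ^ n + 1 ∧
      L.head? = some A ∧
      L.getLast? = some (symmDiff A {j + 2 ^ n}) ∧
      List.Chain' PebbleMove L ∧
      ∀ B ∈ L,
        A \ {j + 2 ^ n} ⊆ B ∧
        B ⊆ A ∪ Finset.Icc (j + 1) (j + 2 ^ n) ∧
        (B \ A).card ≤ n + 1 := by
  obtain ⟨L, h1, h2, h3, h4, h5⟩ := (pebble_aux n A j hj
    (fun i h h' => hgap i (Finset.mem_Ico.2 ⟨h, h'⟩))).toList
  refine ⟨L, h1, h2, h3, h4, fun B hB => ?_⟩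
  obtain ⟨a, b, c⟩ := h5 B hB
  exact ⟨a, b, (Finset.card_le_card
    (Finset.sdiff_subset_sdiff subset_rfl Finset.sdiff_subset)).trans c⟩
end

section
/- For every natural number k there exists a sequence of exactly 3^k legal moves of the reversible pebble game leading from the initial state {0} to the state {0, 2^k}, in which every state occurring in the sequence has cardinality at most k + 2 (i.e., at most k + 1 pebbles besides the permanent pebble on node 0). -/
inductive PPath_s1 (b : ℕ) : ℕ → Finset ℕ → Finset ℕ → Prop
  | nil (A : Finset ℕ) (h : A.card ≤ b) : PPath_s1 b 0 A A
  | cons {n : ℕ} {A B C : Finset ℕ} (h : A.card ≤ b) (m : PebbleMove A B)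
      (p : PPath_s1 b n B C) : PPath_s1 b (n + 1) A C

theorem PebbleMove.symm' {A B : Finset ℕ} (h : PebbleMove A B) : PebbleMove B A := by
  obtain ⟨i, hi, rfl⟩ := h
  refine ⟨i, ?_, ?_⟩
  · simp [Finset.mem_symmDiff, hi]
  · rw [symmDiff_assoc, symmDiff_self, symmDiff_bot]

theorem PPath_s1.trans {b n m : ℕ} {A B C : Finset ℕ} (p : PPath_s1 b n A B) (q : PPath_s1 b m B C) :
    PPath_s1 b (n + m) A C := by
  induction p with
  | nil A h => simpa using q
  | cons h mv p ih =>
    have := PPath_s1.cons h mv (ih q)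
    convert this using 1
    omega

theorem PPath_s1.start {b n : ℕ} {A B : Finset ℕ} (p : PPath_s1 b n A B) : A.card ≤ b := by
  cases p <;> assumption

theorem PPath_s1.symm {b n : ℕ} {A B : Finset ℕ} (p : PPath_s1 b n A B) : PPath_s1 b n B A := by
  induction p with
  | nil A h => exact .nil A h
  | cons h mv p ih => exact ih.trans (.cons p.start mv.symm' (.nil _ h))

theorem PPath_s1.mono {b c n : ℕ} {A B : Finset ℕ} (hbc : b ≤ c) (p : PPath_s1 b n A B) :
    PPath_s1 c n A B := by
  induction p with
  | nil A h => exact .nil A (h.trans hbc)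
  | cons h mv p ih => exact .cons (h.trans hbc) mv ih

theorem PPath_s1.list {b n : ℕ} {A B : Finset ℕ} (p : PPath_s1 b n A B) :
    ∃ L : List (Finset ℕ), L.length = n ∧ (A :: L).getLast? = some B ∧
      List.IsChain PebbleMove (A :: L) ∧ ∀ C ∈ A :: L, C.card ≤ b := by
  induction p with
  | nil A h => exact ⟨[], by simp [h]⟩
  | @cons n A B C h mv p ih =>
    obtain ⟨L, h1, h2, h3, h4⟩ := ih
    refine ⟨B :: L, by simp [h1], by rw [List.getLast?_cons_cons]; exact h2,
      List.isChain_cons_cons.2 ⟨mv, h3⟩, ?_⟩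
    intro D hD
    rcases List.mem_cons.1 hD with rfl | hD
    · exact h
    · exact h4 D hD

theorem bennett (k : ℕ) : ∀ (C : Finset ℕ) (i : ℕ), i ∈ C →
    (∀ j ∈ C, j ≤ i ∨ i + 2 ^ k < j) →
    PPath_s1 (C.card + k + 1) (3 ^ k) C (insert (i + 2 ^ k) C) := by
  induction k with
  | zero =>
    intro C i hi hC
    refine .cons (by omega) ⟨i, hi, rfl⟩ ?_
    have hn : i + 1 ∉ C := fun h => by have := hC _ h; omega
    have : symmDiff C {i + 1} = insert (i + 2 ^ 0) C := by
      ext x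
      simp only [Finset.mem_symmDiff, Finset.mem_singleton, Finset.mem_insert, pow_zero]
      grind
    rw [this]
    exact .nil _ (Finset.card_insert_le _ _)
  | succ k ih =>
    intro C i hi hC
    have hp : 0 < 2 ^ k := by positivity
    have e2 : 2 ^ (k + 1) = 2 ^ k + 2 ^ k := by ring
    rw [e2] at hC ⊢
    generalize 2 ^ k = t at *
    have p1 := ih C i hi (fun j hj => by have := hC j hj; omega)
    have p2 := ih (insert (i + t) C) (i + t) (by simp) (fun j hj => by
      rcases Finset.mem_insert.1 hj with rfl | hj
      · omega
      · have := hC j hj; omega)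
    have p3 := ih (insert (i + (t + t)) C) i (by simp [hi]) (fun j hj => by
      rcases Finset.mem_insert.1 hj with rfl | hj
      · omega
      · have := hC j hj; omega)
    have c1 := Finset.card_insert_le (i + t) C
    have c2 := Finset.card_insert_le (i + (t + t)) C
    rw [Finset.insert_comm] at p3
    rw [show i + t + t = i + (t + t) by omega] at p2
    have e3 : 3 ^ (k + 1) = 3 ^ k + (3 ^ k + 3 ^ k) := by ring
    rw [e3]
    exact (p1.mono (by omega)).trans ((p2.mono (by omega)).trans (p3.symm.mono (by omega)))

/-- Effect of the top-level call `pebble(−1, k, k)` of Bennett's reversible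
simulation: there is a sequence of exactly `3^k` legal moves of the reversible
pebble game from the initial state `{0}` to the state `{0, 2^k}`, in which
every state has cardinality at most `k + 2` (at most `k + 1` pebbles besides
the permanent pebble on node 0). -/
theorem pebble_top_level (k : ℕ) :
    ∃ L : List (Finset ℕ),
      L.length = 3 ^ k + 1 ∧
      L.head? = some ({0} : Finset ℕ) ∧
      L.getLast? = some ({0, 2 ^ k} : Finset ℕ) ∧
      List.Chain' PebbleMove L ∧
      ∀ B ∈ L, B.card ≤ k + 2 := by
  have p := bennett k {0} 0 (by simp) (by simp)
  obtain ⟨L, h1, h2, h3, h4⟩ := p.list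
  refine ⟨{0} :: L, by simp [h1], rfl, ?_, h3, ?_⟩
  · rw [h2, zero_add, Finset.pair_comm]
  · intro B hB
    have := h4 B hB
    simp only [Finset.card_singleton] at this
    omega
end

section
/- For every natural number n, every state A of the reversible pebble game, and every node j ∈ A such that none of the nodes j+1, ..., j+2^n − 1 belongs to A, there exists a single list L of 3^n nodes such that: (1) successively toggling the nodes of L starting from state A is a legal move sequence ending in the state A Δ {j + 2^n}; and (2) successively toggling the nodes of L starting from the state A Δ {j + 2^n} is also a legal move sequence, ending back in A. In particular, executing the list L twice starting from A produces no net change. -/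
/-- Toggle the pebble on node `m`: replace `A` by `A ∆ {m}`. -/
def pebbleToggle (A : Finset ℕ) (m : ℕ) : Finset ℕ :=
  symmDiff A {m}

/-- Run a list of toggles from a state. -/
def pebbleRun (A : Finset ℕ) (L : List ℕ) : Finset ℕ :=
  L.foldl pebbleToggle A

/-- A list of toggles is legal from a state if each toggle's precondition
(the predecessor node being pebbled) holds when it is executed:
toggling node `m` is legal from `A` iff `m = i + 1` for some `i ∈ A`. -/
def PebbleLegal : Finset ℕ → List ℕ → Prop
  | _, [] => True
  | A, m :: L => (∃ i ∈ A, m = i + 1) ∧ PebbleLegal (pebbleToggle A m) L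

theorem pebbleLegal_append (A : Finset ℕ) (L M : List ℕ) (h1 : PebbleLegal A L)
    (h2 : PebbleLegal (pebbleRun A L) M) : PebbleLegal A (L ++ M) := by
  induction L generalizing A with
  | nil => simpa [pebbleRun] using h2
  | cons m L ih =>
    obtain ⟨ha, hb⟩ := h1
    exact ⟨ha, ih _ hb h2⟩

def pebbleList : ℕ → ℕ → List ℕ
  | 0, j => [j + 1]
  | n + 1, j => pebbleList n j ++ (pebbleList n (j + 2 ^ n) ++ pebbleList n j)

theorem pebbleList_length (n j : ℕ) : (pebbleList n j).length = 3 ^ n := by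
  induction n generalizing j with
  | zero => simp [pebbleList]
  | succ n ih => simp only [pebbleList, List.length_append, ih]; ring

theorem pebbleRun_append (A : Finset ℕ) (L M : List ℕ) :
    pebbleRun A (L ++ M) = pebbleRun (pebbleRun A L) M := by
  simp [pebbleRun]

theorem pebbleList_spec (n : ℕ) (A : Finset ℕ) (j : ℕ) (hj : j ∈ A)
    (hgap : ∀ i, j < i → i < j + 2 ^ n → i ∉ A) :
    PebbleLegal A (pebbleList n j) ∧
      pebbleRun A (pebbleList n j) = symmDiff A {j + 2 ^ n} := by
  induction n generalizing A j with
  | zero => exact ⟨⟨⟨j, hj, rfl⟩, trivial⟩, by simp [pebbleRun, pebbleList, pebbleToggle]⟩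
  | succ n ih =>
    have hp : 0 < 2 ^ n := by positivity
    have e : 2 ^ (n + 1) = 2 ^ n + 2 ^ n := by ring
    rw [e] at hgap ⊢
    simp only [pebbleList]
    generalize hk : 2 ^ n = k at *
    have hm : j + k ∉ A := hgap _ (by omega) (by omega)
    obtain ⟨l1, r1⟩ := ih A j hj (fun i a b => hgap i a (by omega))
    obtain ⟨l2, r2⟩ := ih (symmDiff A {j + k}) (j + k)
      (by simp [Finset.mem_symmDiff, hm])
      (fun i a b => by
        have := hgap i (by omega) (by omega)
        simp [Finset.mem_symmDiff, this]; omega)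
    obtain ⟨l3, r3⟩ := ih (symmDiff (symmDiff A {j + k}) {j + k + k}) j
      (by simp [Finset.mem_symmDiff, hj]; omega)
      (fun i a b => by
        have := hgap i (by omega) (by omega)
        simp [Finset.mem_symmDiff, this]; omega)
    constructor
    · refine pebbleLegal_append _ _ _ l1 (pebbleLegal_append _ _ _ ?_ ?_)
      · rw [r1]; exact l2
      · rw [r1, r2]; exact l3
    · rw [pebbleRun_append, pebbleRun_append, r1, r2, r3, ← add_assoc,
        symmDiff_right_comm, symmDiff_symmDiff_cancel_right]

/-- The procedure `pebble(s,t,n)` is its own reverse: for a state `A`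
(containing the permanent pebble on node 0) with `j ∈ A` and no pebbles on
`j+1, …, j+2^n − 1`, there is a single list `L` of `3^n` toggles that is a
legal move sequence from `A` ending in `A ∆ {j + 2^n}`, and is also a legal
move sequence from `A ∆ {j + 2^n}` ending back in `A`; hence executing `L`
twice from `A` produces no net change. -/
theorem pebble_self_inverse (n : ℕ) (A : Finset ℕ) (j : ℕ)
    (h0 : 0 ∈ A) (hj : j ∈ A)
    (hgap : ∀ i ∈ Finset.Ico (j + 1) (j + 2 ^ n), i ∉ A) :
    ∃ L : List ℕ,
      L.length = 3 ^ n ∧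
      PebbleLegal A L ∧
      pebbleRun A L = symmDiff A {j + 2 ^ n} ∧
      PebbleLegal (symmDiff A {j + 2 ^ n}) L ∧
      pebbleRun (symmDiff A {j + 2 ^ n}) L = A := by
  have hp : 0 < 2 ^ n := by positivity
  obtain ⟨l1, r1⟩ := pebbleList_spec n A j hj
    (fun i a b => hgap i (Finset.mem_Ico.2 ⟨a, b⟩))
  obtain ⟨l2, r2⟩ := pebbleList_spec n (symmDiff A {j + 2 ^ n}) j
    (by simp [Finset.mem_symmDiff, hj])
    (fun i a b => by
      have := hgap i (Finset.mem_Ico.2 ⟨a, b⟩)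
      simp [Finset.mem_symmDiff, this]; omega)
  exact ⟨pebbleList n j, pebbleList_length n j, l1, r1, l2,
    by rw [r2, symmDiff_symmDiff_cancel_right]⟩
end

section
/- Consider any sequence of legal moves of the reversible pebble game starting from the initial state {0}, in which every state occurring in the sequence has cardinality at most n + 1 (that is, at most n pebbles are simultaneously on the board besides the permanent pebble on node 0). Then every node that is pebbled in any state of the sequence is at most 2^{n+1} − 1. -/
inductive PGood (n : ℕ) : Finset ℕ → ℕ → Prop
  | base : PGood n {0} n
  | step (A : Finset ℕ) (s a c : ℕ) (ha : a ∈ A) (hc : c ∈ A) (hlt : c < a)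
      (hgap : a ≤ c + 2 ^ s) (h : PGood n (A.erase a) (s + 1)) : PGood n A s

theorem PGood.bound {n : ℕ} {A : Finset ℕ} {s : ℕ} (h : PGood n A s) :
    ∀ m ∈ A, m + 2 ^ s ≤ 2 ^ n := by
  induction h with
  | base => simp
  | step A s a c ha hc hlt hgap h ih =>
    intro m hm
    have e : 2 ^ (s + 1) = 2 ^ s + 2 ^ s := by ring
    by_cases hma : m = a
    · have := ih c (Finset.mem_erase.2 ⟨by omega, hc⟩)
      omega
    · have := ih m (Finset.mem_erase.2 ⟨hma, hm⟩)
      omega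

theorem PGood.card {n : ℕ} {A : Finset ℕ} {s : ℕ} (h : PGood n A s) :
    A.card + s = n + 1 := by
  induction h with
  | base => simp; omega
  | step A s a c ha hc hlt hgap h ih =>
    have := Finset.card_erase_add_one ha
    omega

theorem PGood.remove {n : ℕ} {A : Finset ℕ} {s : ℕ} (h : PGood n A s) :
    ∀ b ∈ A, ∀ d ∈ A, d < b → b ≤ d + 2 ^ s → PGood n (A.erase b) (s + 1) := by
  induction h with
  | base =>
    intro b hb d hd hlt
    simp at hb hd
    omega
  | step A s a c ha hc hlt hgap h ih =>
    intro b hb d hd hlt' hgap'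
    have e : 2 ^ (s + 1) = 2 ^ s + 2 ^ s := by ring
    by_cases hab : b = a
    · subst hab; exact h
    have h1 : PGood n ((A.erase a).erase b) (s + 1 + 1) := by
      have hb' : b ∈ A.erase a := Finset.mem_erase.2 ⟨hab, hb⟩
      by_cases hda : d = a
      · exact ih b hb' c (Finset.mem_erase.2 ⟨by omega, hc⟩) (by omega) (by omega)
      · exact ih b hb' d (Finset.mem_erase.2 ⟨hda, hd⟩) hlt' (by omega)
    rw [Finset.erase_right_comm] at h1
    have ha' : a ∈ A.erase b := Finset.mem_erase.2 ⟨Ne.symm hab, ha⟩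
    by_cases hcb : c = b
    · exact .step _ _ a d ha' (Finset.mem_erase.2 ⟨by omega, hd⟩) (by omega) (by omega) h1
    · exact .step _ _ a c ha' (Finset.mem_erase.2 ⟨hcb, hc⟩) hlt (by omega) h1

theorem PGood.move {n : ℕ} {A B : Finset ℕ} {s : ℕ} (h : PGood n A s)
    (hm : PebbleMove A B) (hB : B.card ≤ n + 1) : ∃ t, PGood n B t := by
  obtain ⟨i, hi, rfl⟩ := hm
  by_cases hi1 : i + 1 ∈ A
  · have e : symmDiff A {i + 1} = A.erase (i + 1) := by
      ext x; simp only [Finset.mem_symmDiff, Finset.mem_singleton, Finset.mem_erase]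
      grind
    rw [e]
    exact ⟨_, h.remove _ hi1 i hi (by omega) (by have := Nat.one_le_two_pow (n := s); omega)⟩
  · have e : symmDiff A {i + 1} = insert (i + 1) A := by
      ext x; simp only [Finset.mem_symmDiff, Finset.mem_singleton, Finset.mem_insert]
      grind
    rw [e] at hB ⊢
    rw [Finset.card_insert_of_notMem hi1] at hB
    have hc := h.card
    obtain ⟨t, rfl⟩ : ∃ t, s = t + 1 := ⟨s - 1, by omega⟩
    refine ⟨t, .step _ _ (i + 1) i (by simp) (by simp [hi]) (by omega)
      (by have := Nat.one_le_two_pow (n := t); omega) ?_⟩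
    rwa [Finset.erase_insert hi1]

theorem PGood.chain {n : ℕ} (L : List (Finset ℕ)) : ∀ (A : Finset ℕ) (s : ℕ), PGood n A s →
    List.IsChain PebbleMove (A :: L) → (∀ B ∈ L, B.card ≤ n + 1) →
    ∀ B ∈ A :: L, ∃ t, PGood n B t := by
  induction L with
  | nil =>
    intro A s h _ _ B hB
    simp at hB
    subst hB
    exact ⟨s, h⟩
  | cons C L ih =>
    intro A s h hch hcard B hB
    rw [List.isChain_cons_cons] at hch
    rcases List.mem_cons.1 hB with rfl | hB
    · exact ⟨s, h⟩
    · obtain ⟨t, ht⟩ := h.move hch.1 (hcard C (by simp))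
      exact ih C t ht hch.2 (fun D hD => hcard D (by simp [hD])) B hB

/-- Optimality bound for the reversible pebble game: in any sequence of legal
moves starting from the initial state `{0}` in which every state has
cardinality at most `n + 1` (at most `n` pebbles besides the permanent pebble
on node 0), every node pebbled in any state of the sequence is at most
`2^(n+1) − 1`. -/
theorem pebble_reach_bound (n : ℕ) (L : List (Finset ℕ))
    (hchain : List.Chain' PebbleMove L)
    (hhead : L.head? = some ({0} : Finset ℕ))
    (hcard : ∀ B ∈ L, B.card ≤ n + 1) :
    ∀ B ∈ L, ∀ m ∈ B, m ≤ 2 ^ (n + 1) - 1 := by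
  intro B hB m hm
  cases L with
  | nil => simp at hB
  | cons A L =>
    simp at hhead
    subst hhead
    obtain ⟨t, ht⟩ := PGood.chain L {0} n .base hchain
      (fun D hD => hcard D (by simp [hD])) B hB
    have h1 := ht.bound m hm
    have h2 := Nat.one_le_two_pow (n := t)
    have e : 2 ^ (n + 1) = 2 ^ n + 2 ^ n := by ring
    omega
end

section
/- Let G be a finite simple graph that is a tree (connected and acyclic) and has at least one edge. Let σ be a permutation of the darts (half-edges) of G such that for every dart d the dart σ(d) has the same initial vertex as d, and such that for every vertex v, σ acts as a single cycle on the set of darts with initial vertex v (that is, for any two darts d, d' with the same initial vertex v there is a natural number k with σ^k(d) = d'). Define the map ρ on darts by ρ(d) = σ(d.symm), where d.symm is the reversal of dart d. Then ρ is a permutation of the darts of G acting as a single cycle on the set of all darts: for any two darts d, d' there is a natural number k with ρ^k(d) = d'. -/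
/-- The combinatorial fact underlying the Lange–McKenzie–Tapp reversible
traversal: let `G` be a finite tree with at least one edge, and let `σ` be a
permutation of the darts of `G` fixing initial vertices and acting as a
single cycle on the darts out of each vertex (the "rotation" permutation).
Then `ρ(d) = σ(d.symm)` (rotation composed with the edge-swapping
permutation) is a permutation of the darts acting as a single cycle on the
set of all darts. -/
theorem tree_dart_single_cycle {V : Type*} [Fintype V] (G : SimpleGraph V)
    (htree : G.IsTree) (hedge : G.edgeSet.Nonempty)
    (σ : Equiv.Perm G.Dart)
    (hfix : ∀ d : G.Dart, (σ d).fst = d.fst)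
    (hcyc : ∀ d d' : G.Dart, d.fst = d'.fst → ∃ k : ℕ, (σ ^ k) d = d') :
    Function.Bijective (fun d : G.Dart => σ d.symm) ∧
      ∀ d d' : G.Dart, ∃ k : ℕ, (fun d : G.Dart => σ d.symm)^[k] d = d' := by
  classical
  have hinv : Function.Involutive (SimpleGraph.Dart.symm : G.Dart → G.Dart) :=
    SimpleGraph.Dart.symm_involutive
  have hfin : Finite G.Dart := inferInstance
  obtain ⟨ρ, hρ⟩ : ∃ ρ : Equiv.Perm G.Dart, ∀ d, ρ d = σ d.symm :=
    ⟨hinv.toPerm.trans σ, fun d => rfl⟩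
  have hfun : (fun d : G.Dart => σ d.symm) = ρ := funext fun d => (hρ d).symm
  rw [hfun]
  refine ⟨ρ.bijective, ?_⟩
  have hfst : ∀ d, (ρ d).fst = d.snd := fun d => by rw [hρ, hfix]; rfl
  have key : ∀ d : G.Dart, ρ.SameCycle d d.symm := by
    intro d
    by_contra hd
    have hbr := (SimpleGraph.isAcyclic_iff_forall_adj_isBridge.1 htree.2) d.adj
    rw [SimpleGraph.isBridge_iff] at hbr
    have hper : 0 < Function.minimalPeriod ρ d :=
      Function.minimalPeriod_pos_of_mem_periodicPts
        (Function.Injective.mem_periodicPts ρ.injective d)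
    have hreach : ∀ i, i < Function.minimalPeriod ρ d →
        (G \ SimpleGraph.fromEdgeSet {s(d.fst, d.snd)}).Reachable d.snd (ρ^[i+1] d).fst := by
      intro i
      induction i with
      | zero => intro _; simp [hfst]
      | succ i ih =>
        intro hi
        refine (ih (by omega)).trans ?_
        rw [Function.iterate_succ_apply' ρ (i+1), hfst]
        set e := ρ^[i+1] d with he
        apply SimpleGraph.Adj.reachable
        rw [SimpleGraph.sdiff_adj]
        refine ⟨e.adj, ?_⟩
        rw [SimpleGraph.fromEdgeSet_adj]
        rintro ⟨h, -⟩
        have h' : e.edge = d.edge := h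
        rw [SimpleGraph.dart_edge_eq_iff] at h'
        rcases h' with h' | h'
        · have : Function.IsPeriodicPt ρ (i+1) d := he.symm.trans h'
          have := this.minimalPeriod_le (by omega)
          omega
        · apply hd
          refine ⟨((i+1 : ℕ) : ℤ), ?_⟩
          rw [zpow_natCast, ← h', he, Equiv.Perm.iterate_eq_pow]
    have := hreach (Function.minimalPeriod ρ d - 1) (by omega)
    rw [Nat.sub_add_cancel hper, Function.iterate_minimalPeriod] at this
    exact hbr this.symm
  have hσ : ∀ e, ρ.SameCycle e (σ e) := by
    intro e
    have h1 : ρ.SameCycle e.symm (ρ e.symm) := Equiv.Perm.sameCycle_apply_right.2 (Equiv.Perm.SameCycle.refl _ _)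
    rw [hρ, SimpleGraph.Dart.symm_symm] at h1
    exact (key e).trans h1
  have hsame : ∀ d d' : G.Dart, d.fst = d'.fst → ρ.SameCycle d d' := by
    intro d d' h
    obtain ⟨k, rfl⟩ := hcyc d d' h
    clear h
    induction k with
    | zero => exact Equiv.Perm.SameCycle.refl _ _
    | succ k ih => rw [pow_succ', Equiv.Perm.mul_apply]; exact ih.trans (hσ _)
  have hall : ∀ (u v : V) (p : G.Walk u v) (d d' : G.Dart), d.fst = u → d'.fst = v →
      ρ.SameCycle d d' := by
    intro u v p
    induction p with
    | nil => intro d d' h h'; exact hsame d d' (h.trans h'.symm)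
    | cons h p ih =>
      intro d d' h1 h2
      let e : G.Dart := ⟨(_, _), h⟩
      exact ((hsame d e h1).trans (key e)).trans (ih e.symm d' rfl h2)
  intro d d'
  obtain ⟨p⟩ := htree.1.preconnected d.fst d'.fst
  obtain ⟨k, hk⟩ := (hall _ _ p d d' rfl rfl).exists_nat_pow_eq
  exact ⟨k, by rw [Equiv.Perm.iterate_eq_pow]; exact hk⟩
end
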